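/- Let Ω ⊂ ℝ² be open, K ⊂ Ω compact with positive one-dimensional Hausdorff content, N a compact manifold, and v ∈ W^{1,2}(Ω \ K, N). Then ∫_{Ω\K} |Dv|²/2 ≥ E^sg(tr_{∂Ω} v) · log( dist(K, ∂Ω) / (2·H¹_∞(K)) ), where H¹_∞(K) is the one-dimensional Hausdorff content of K and E^sg(g) is the singular energy of the boundary trace g. -/

import Mathlib

open Real Metric MeasureTheory ENNReal

/-- A closed loop in `N`, parametrised as a continuous `2π`-periodic map. -/
def IsLoopIn {ν : ℕ} (N : Set (EuclideanSpace ℝ (Fin ν)))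
    (γ : ℝ → EuclideanSpace ℝ (Fin ν)) : Prop :=
  Continuous γ ∧ Function.Periodic γ (2 * π) ∧ ∀ t, γ t ∈ N

/-- Two loops are homotopic within `N`. -/
def LoopHomotopicIn {ν : ℕ} (N : Set (EuclideanSpace ℝ (Fin ν)))
    (f g : ℝ → EuclideanSpace ℝ (Fin ν)) : Prop :=
  ∃ H : ℝ × ℝ → EuclideanSpace ℝ (Fin ν), Continuous H ∧
    (∀ t, H (0, t) = f t) ∧ (∀ t, H (1, t) = g t) ∧
    (∀ p, H p ∈ N) ∧ (∀ s t, H (s, t + 2 * π) = H (s, t))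

/-- Two maps on a topological space `X` are homotopic within `N`. -/
def HomotopicIn {X : Type*} [TopologicalSpace X] {ν : ℕ}
    (N : Set (EuclideanSpace ℝ (Fin ν)))
    (f g : X → EuclideanSpace ℝ (Fin ν)) : Prop :=
  ∃ H : ℝ × X → EuclideanSpace ℝ (Fin ν), Continuous H ∧
    (∀ x, H (0, x) = f x) ∧ (∀ x, H (1, x) = g x) ∧ ∀ p, H p ∈ N

/-- The length of a loop. -/
noncomputable def loopLength {ν : ℕ} (γ : ℝ → EuclideanSpace ℝ (Fin ν)) : ℝ :=
  ∫ t in (0 : ℝ)..(2 * π), ‖deriv γ t‖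

/-- The minimal length `‖γ‖` in the homotopy class of `γ` in `N`. -/
noncomputable def minLength {ν : ℕ} (N : Set (EuclideanSpace ℝ (Fin ν)))
    (γ : ℝ → EuclideanSpace ℝ (Fin ν)) : ℝ :=
  sInf {L | ∃ β, ContDiff ℝ 1 β ∧ IsLoopIn N β ∧ LoopHomotopicIn N γ β ∧
    L = loopLength β}

/-- The one-dimensional Hausdorff content of a set `K ⊆ ℝ² ≃ ℂ`. -/
noncomputable def H1content (K : Set ℂ) : ℝ≥0∞ :=
  ⨅ (s : Finset (ℂ × ℝ)) (_ : K ⊆ ⋃ p ∈ s, closedBall p.1 p.2),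
    ∑ p ∈ s, ENNReal.ofReal (2 * p.2)

/-- `(γ₁, …, γ_k)` is a topological resolution of the boundary datum `g` on
`∂Ω`: there are disjoint closed disks `B̄_ρ(aᵢ) ⊆ Ω` and a continuous
`N`-valued map `u` on `Ω̄` minus the open disks whose restriction to `∂Ω` is
homotopic to `g` within `N` and whose restriction to `∂B_ρ(aᵢ)` is homotopic
to `γᵢ` within `N`. -/
def TopResolution {ν : ℕ} (N : Set (EuclideanSpace ℝ (Fin ν))) (Ω : Set ℂ)
    (g : ℂ → EuclideanSpace ℝ (Fin ν)) {k : ℕ}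
    (γs : Fin k → ℝ → EuclideanSpace ℝ (Fin ν)) : Prop :=
  ∃ (a : Fin k → ℂ) (ρ : ℝ), 0 < ρ ∧
    (∀ i, closedBall (a i) ρ ⊆ Ω) ∧
    (∀ i j, i ≠ j → Disjoint (closedBall (a i) ρ) (closedBall (a j) ρ)) ∧
    ∃ u : ℂ → EuclideanSpace ℝ (Fin ν),
      ContinuousOn u (closure Ω \ ⋃ i, ball (a i) ρ) ∧
      (∀ x ∈ closure Ω \ ⋃ i, ball (a i) ρ, u x ∈ N) ∧
      HomotopicIn N (fun x : frontier Ω => u x.1) (fun x => g x.1) ∧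
      ∀ i, LoopHomotopicIn N
        (fun t => u (a i + (ρ : ℂ) * Complex.exp (t * Complex.I))) (γs i)

/-- The singular energy `E^sg(g)` of a boundary datum `g` on `∂Ω`: the infimum
over topological resolutions `(γ₁, …, γ_k)` of `g` of `Σᵢ ‖γᵢ‖²/(4π)`. -/
noncomputable def singularEnergy {ν : ℕ} (N : Set (EuclideanSpace ℝ (Fin ν)))
    (Ω : Set ℂ) (g : ℂ → EuclideanSpace ℝ (Fin ν)) : ℝ :=
  sInf {e | ∃ (k : ℕ), 1 ≤ k ∧ ∃ γs : Fin k → ℝ → EuclideanSpace ℝ (Fin ν),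
    (∀ i, IsLoopIn N (γs i)) ∧ TopResolution N Ω g γs ∧
    e = ∑ i : Fin k, (minLength N (γs i)) ^ 2 / (4 * π)}

theorem Continuous.uniformContinuous_of_periodic {E : Type*} [PseudoMetricSpace E] {f : ℝ → E}
    (hf : Continuous f) {T : ℝ} (hT : 0 < T) (hp : Function.Periodic f T) :
    UniformContinuous f := by
  rw [Metric.uniformContinuous_iff]
  intro ε hε
  have h := (isCompact_Icc (a := (0 : ℝ)) (b := T)).uniformContinuousAt_of_continuousAt f
    (fun a _ => hf.continuousAt) (Metric.dist_mem_uniformity hε)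
  obtain ⟨δ, hδ, h⟩ := Metric.mem_uniformity_dist.1 h
  refine ⟨δ, hδ, fun {a b} hab => ?_⟩
  have hmod : ∀ x, f (x - ⌊a / T⌋ * T) = f x := fun x => hp.sub_int_mul_eq _
  have h0 : a - ⌊a / T⌋ * T ∈ Set.Icc 0 T := by
    have h1 := Int.floor_le (a / T)
    have h2 := (Int.lt_floor_add_one (a / T)).le
    rw [le_div_iff₀ hT] at h1
    rw [div_le_iff₀ hT] at h2
    constructor <;> linarith
  have := h (a := a - ⌊a / T⌋ * T) (b := b - ⌊a / T⌋ * T) (by simpa using hab) h0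
  simpa only [hmod, Set.mem_ofPred_eq] using this

/-- A uniform neighbourhood of the compact set `N` lies in `U`, and there the derivative of `r`
differs by less than `η` from its values at nearby points of `N`. -/
theorem exists_uniform_nhd_of_retraction {E : Type*} [NormedAddCommGroup E] [NormedSpace ℝ E]
    {N U : Set E} (hN : IsCompact N) (hU : IsOpen U) (hNU : N ⊆ U) {r : E → E}
    (hr : ContDiffOn ℝ 1 r U) {η : ℝ} (hη : 0 < η) :
    ∃ δ > 0, ∀ x ∈ N, ∀ y, dist x y < δ → y ∈ U ∧ ‖fderiv ℝ r y - fderiv ℝ r x‖ < η := by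
  have hc : ContinuousOn (fderiv ℝ r) U := hr.continuousOn_fderiv_of_isOpen hU le_rfl
  have h := hN.uniformContinuousAt_of_continuousAt (fderiv ℝ r)
    (fun a ha => hc.continuousAt (hU.mem_nhds (hNU ha))) (Metric.dist_mem_uniformity hη)
  obtain ⟨δ, hδ, h⟩ := Metric.mem_uniformity_dist.1 h
  obtain ⟨δ', hδ', h'⟩ := hN.exists_thickening_subset_open hU hNU
  refine ⟨min δ δ', lt_min hδ hδ', fun x hx y hxy => ⟨h' ?_, ?_⟩⟩
  · exact Metric.mem_thickening_iff.2 ⟨x, hx, by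
      rw [dist_comm]; exact hxy.trans_le (min_le_right _ _)⟩
  · have := h (hxy.trans_le (min_le_left _ _)) hx
    rwa [Set.mem_ofPred_eq, dist_comm, dist_eq_norm] at this

theorem Function.Periodic.integral_integral_shift {g : ℝ → ℝ} {T : ℝ}
    (hp : Function.Periodic g T) (hi : ∀ a b, IntervalIntegrable g volume a b) (ε : ℝ) :
    ∫ t in (0 : ℝ)..T, ∫ s in t..t + ε, g s = ε * ∫ t in (0 : ℝ)..T, g t := by
  set G : ℝ → ℝ := fun t => ∫ s in (0 : ℝ)..t, g s with hG
  have hGc : Continuous G := intervalIntegral.continuous_primitive hi 0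
  have hGi : ∀ a b, IntervalIntegrable G volume a b := fun a b => hGc.intervalIntegrable a b
  have h1 : ∀ t, ∫ s in t..t + ε, g s = G (t + ε) - G t := fun t =>
    (intervalIntegral.integral_interval_sub_left (hi _ _) (hi _ _)).symm
  have h2 : ∀ t, G (t + T) = G t + ∫ t in (0 : ℝ)..T, g t := fun t => by
    have := hp.intervalIntegral_add_eq_add 0 t hi
    simpa [hG] using this
  simp_rw [h1]
  have hGs : IntervalIntegrable (fun t => G (t + ε)) volume 0 T :=
    (hGc.comp (continuous_add_const ε)).intervalIntegrable _ _
  rw [intervalIntegral.integral_sub hGs (hGi _ _), intervalIntegral.integral_comp_add_right]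
  have h4 : ∫ t in T..T + ε, G t = (∫ t in (0 : ℝ)..ε, G t) + ε * ∫ t in (0 : ℝ)..T, g t := by
    have h5 := intervalIntegral.integral_comp_add_right (a := 0) (b := ε) G T
    rw [zero_add, add_comm ε T] at h5
    rw [← h5]
    simp_rw [h2]
    rw [intervalIntegral.integral_add (hGi _ _) (by simp)]
    simp
  have e1 := intervalIntegral.integral_add_adjacent_intervals (hGi 0 T) (hGi T (T + ε))
  have e2 := intervalIntegral.integral_add_adjacent_intervals (hGi 0 ε) (hGi ε (T + ε))
  rw [zero_add]
  linarith

theorem loopLength_nonneg {ν : ℕ} (γ : ℝ → EuclideanSpace ℝ (Fin ν)) : 0 ≤ loopLength γ :=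
  intervalIntegral.integral_nonneg (by positivity) fun _ _ => norm_nonneg _

theorem minLength_nonneg {ν : ℕ} (N : Set (EuclideanSpace ℝ (Fin ν)))
    (γ : ℝ → EuclideanSpace ℝ (Fin ν)) : 0 ≤ minLength N γ := by
  apply Real.sInf_nonneg
  rintro _ ⟨β, -, -, -, rfl⟩
  exact loopLength_nonneg β

theorem minLength_le_loopLength {ν : ℕ} {N : Set (EuclideanSpace ℝ (Fin ν))}
    {γ β : ℝ → EuclideanSpace ℝ (Fin ν)} (hβ : ContDiff ℝ 1 β) (hβN : IsLoopIn N β)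
    (h : LoopHomotopicIn N γ β) : minLength N γ ≤ loopLength β := by
  apply csInf_le
  · refine ⟨0, ?_⟩
    rintro _ ⟨β, -, -, -, rfl⟩
    exact loopLength_nonneg β
  · exact ⟨β, hβ, hβN, h, rfl⟩

theorem minLength_le_of_hasDerivAt {ν : ℕ} {N U : Set (EuclideanSpace ℝ (Fin ν))}
    (hN : IsCompact N) (hU : IsOpen U) (hNU : N ⊆ U)
    {r : EuclideanSpace ℝ (Fin ν) → EuclideanSpace ℝ (Fin ν)}
    (hr : ContDiffOn ℝ 1 r U) (hrN : ∀ x ∈ U, r x ∈ N) (hrid : ∀ x ∈ N, r x = x)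
    {γ γ' : ℝ → EuclideanSpace ℝ (Fin ν)} (hγ : IsLoopIn N γ)
    (hd : ∀ t, HasDerivAt γ (γ' t) t)
    (hi : IntervalIntegrable γ' volume 0 (2 * π)) :
    minLength N γ ≤ ∫ t in (0 : ℝ)..(2 * π), ‖γ' t‖ := by
  obtain ⟨hγc, hγp, hγN⟩ := hγ
  have hπ : (0 : ℝ) < 2 * π := by positivity
  have hγ'p : Function.Periodic γ' (2 * π) := fun t => by
    have h := (hd (t + 2 * π)).comp_add_const t (2 * π)
    rw [funext hγp] at h
    exact h.unique (hd t)
  have hi' : ∀ a b, IntervalIntegrable γ' volume a b := hγ'p.intervalIntegrable₀ hπ.ne' hi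
  have hfix : ∀ t, fderiv ℝ r (γ t) (γ' t) = γ' t := fun t => by
    have h1 : DifferentiableAt ℝ r (γ t) :=
      (hr.contDiffAt (hU.mem_nhds (hNU (hγN t)))).differentiableAt one_ne_zero
    have h2 := h1.hasFDerivAt.comp_hasDerivAt t (hd t)
    rw [show r ∘ γ = γ from funext fun s => hrid _ (hγN s)] at h2
    exact h2.unique (hd t)
  suffices h : ∀ η > 0, minLength N γ ≤ (1 + η) * ∫ t in (0 : ℝ)..(2 * π), ‖γ' t‖ by
    have ht : Filter.Tendsto (fun η : ℝ => (1 + η) * ∫ t in (0 : ℝ)..(2 * π), ‖γ' t‖)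
        (nhdsWithin 0 (Set.Ioi 0)) (nhds ((1 + 0) * ∫ t in (0 : ℝ)..(2 * π), ‖γ' t‖)) :=
      Filter.Tendsto.mono_left (Continuous.tendsto (by fun_prop) 0) nhdsWithin_le_nhds
    rw [add_zero, one_mul] at ht
    exact ge_of_tendsto ht (Filter.eventually_of_mem self_mem_nhdsWithin h)
  intro η hη
  obtain ⟨δ, hδ, hδU⟩ := exists_uniform_nhd_of_retraction hN hU hNU hr hη
  obtain ⟨ε₀, hε₀, hγu⟩ := Metric.uniformContinuous_iff.1
    (hγc.uniformContinuous_of_periodic hπ hγp) (δ / 2) (half_pos hδ)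
  set ε := ε₀ / 2 with hεdef
  have hε : 0 < ε := half_pos hε₀
  have hγi : ∀ a b, IntervalIntegrable γ volume a b := fun a b => hγc.intervalIntegrable a b
  set m : ℝ → EuclideanSpace ℝ (Fin ν) := fun t => ε⁻¹ • ∫ s in t..t + ε, γ s with hm
  have hmclose : ∀ t, ∀ s ∈ Set.Icc t (t + ε), dist (γ s) (m t) < δ := fun t s hs => by
    have h1 : m t - γ s = ε⁻¹ • ∫ τ in t..t + ε, (γ τ - γ s) := by
      rw [intervalIntegral.integral_sub (hγi _ _) (by simp)]
      simp [hm, smul_sub, smul_smul, inv_mul_cancel₀ hε.ne']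
    have h2 : ‖∫ τ in t..t + ε, (γ τ - γ s)‖ ≤ δ / 2 * |t + ε - t| := by
      apply intervalIntegral.norm_integral_le_of_norm_le_const
      intro τ hτ
      rw [Set.uIoc_of_le (by linarith)] at hτ
      rw [← dist_eq_norm]
      apply (hγu _).le
      rw [Real.dist_eq, abs_lt]
      constructor <;> linarith [hτ.1, hτ.2, hs.1, hs.2]
    rw [dist_comm, dist_eq_norm, h1, norm_smul, Real.norm_eq_abs, abs_of_pos (inv_pos.2 hε)]
    rw [add_sub_cancel_left, abs_of_pos hε] at h2
    calc ε⁻¹ * _ ≤ ε⁻¹ * (δ / 2 * ε) := by gcongr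
      _ = δ / 2 := by field_simp
      _ < δ := half_lt_self hδ
  have hmder : ∀ t, HasDerivAt m (ε⁻¹ • ∫ s in t..t + ε, γ' s) t := fun t => by
    have hP : ∀ x, HasDerivAt (fun x => ∫ s in (0 : ℝ)..x, γ s) (γ x) x := fun x =>
      intervalIntegral.integral_hasDerivAt_right (hγi _ _)
        (hγc.stronglyMeasurableAtFilter _ _) hγc.continuousAt
    rw [intervalIntegral.integral_eq_sub_of_hasDerivAt (fun x _ => hd x) (hi' _ _)]
    have h := (((hP (t + ε)).comp_add_const t ε).sub (hP t)).const_smul ε⁻¹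
    refine h.congr_of_eventuallyEq (Filter.Eventually.of_forall fun x => ?_)
    simp only [hm, Pi.sub_apply, Pi.smul_apply]
    rw [intervalIntegral.integral_interval_sub_left (hγi _ _) (hγi _ _)]
  have hmU : ∀ t, m t ∈ U := fun t =>
    (hδU _ (hγN t) _ (hmclose t t ⟨le_rfl, by linarith⟩)).1
  have hmC1 : ContDiff ℝ 1 m := by
    rw [contDiff_one_iff_deriv]
    refine ⟨fun t => (hmder t).differentiableAt, ?_⟩
    have : deriv m = fun t => ε⁻¹ • (γ (t + ε) - γ t) := funext fun t => by
      rw [(hmder t).deriv,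
        intervalIntegral.integral_eq_sub_of_hasDerivAt (fun x _ => hd x) (hi' _ _)]
    rw [this]
    fun_prop
  have hmp : Function.Periodic m (2 * π) := fun t => by
    simp only [hm]
    congr 1
    rw [add_right_comm, ← intervalIntegral.integral_comp_add_right (a := t) (b := t + ε)]
    simp_rw [hγp _]
  have hβC1 : ContDiff ℝ 1 (r ∘ m) := contDiff_iff_contDiffAt.2 fun t =>
    (hr.contDiffAt (hU.mem_nhds (hmU t))).comp t hmC1.contDiffAt
  have hβloop : IsLoopIn N (r ∘ m) :=
    ⟨hβC1.continuous, fun t => congrArg r (hmp t), fun t => hrN _ (hmU t)⟩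
  have hhom : LoopHomotopicIn N γ (r ∘ m) := by
    set P : ℝ × ℝ → EuclideanSpace ℝ (Fin ν) :=
      fun p => γ p.2 + (max 0 (min 1 p.1)) • (m p.2 - γ p.2) with hP
    have hPU : ∀ p, P p ∈ U := fun p => by
      refine (hδU _ (hγN p.2) _ ?_).1
      have h0 : (0 : ℝ) ≤ max 0 (min 1 p.1) := le_max_left _ _
      have h1 : max 0 (min 1 p.1) ≤ 1 := max_le zero_le_one (min_le_left _ _)
      have h2 := hmclose p.2 p.2 ⟨le_rfl, by linarith⟩
      rw [dist_comm, dist_eq_norm] at h2 ⊢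
      simp only [hP, add_sub_cancel_left, norm_smul, Real.norm_eq_abs, abs_of_nonneg h0]
      nlinarith [norm_nonneg (m p.2 - γ p.2)]
    have hmc := hmC1.continuous
    have hPc : Continuous P := by fun_prop
    refine ⟨r ∘ P, ?_, fun t => ?_, fun t => ?_, fun p => hrN _ (hPU p), fun s t => ?_⟩
    · exact hr.continuousOn.comp_continuous hPc hPU
    · simp [hP, hrid _ (hγN t)]
    · simp [hP]
    · simp [hP, hγp t, hmp t]
  refine (minLength_le_loopLength hβC1 hβloop hhom).trans ?_
  have hderiv : ∀ t, ‖deriv (r ∘ m) t‖ ≤ (1 + η) * ε⁻¹ * ∫ s in t..t + ε, ‖γ' s‖ := fun t => by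
    have h1 : DifferentiableAt ℝ r (m t) :=
      (hr.contDiffAt (hU.mem_nhds (hmU t))).differentiableAt one_ne_zero
    rw [(h1.hasFDerivAt.comp_hasDerivAt t (hmder t)).deriv, map_smul, norm_smul, norm_inv,
      Real.norm_eq_abs, abs_of_pos hε,
      ← ContinuousLinearMap.intervalIntegral_comp_comm _ (hi' _ _), mul_comm (1 + η), mul_assoc]
    gcongr
    rw [← intervalIntegral.integral_const_mul]
    apply intervalIntegral.norm_integral_le_of_norm_le (by linarith)
    · refine Filter.Eventually.of_forall fun s hs => ?_
      have h2 := (hδU _ (hγN s) _ (hmclose t s ⟨hs.1.le, hs.2⟩)).2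
      calc ‖fderiv ℝ r (m t) (γ' s)‖
          = ‖γ' s + (fderiv ℝ r (m t) - fderiv ℝ r (γ s)) (γ' s)‖ := by
            rw [_root_.sub_apply, hfix, add_sub_cancel]
        _ ≤ ‖γ' s‖ + ‖fderiv ℝ r (m t) - fderiv ℝ r (γ s)‖ * ‖γ' s‖ :=
            (norm_add_le _ _).trans (by gcongr; exact ContinuousLinearMap.le_opNorm _ _)
        _ ≤ (1 + η) * ‖γ' s‖ := by nlinarith [norm_nonneg (γ' s)]
    · exact (hi' _ _).norm.const_mul _
  have hgi : ∀ a b, IntervalIntegrable (fun s => ‖γ' s‖) volume a b := fun a b => (hi' a b).norm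
  have hGc : Continuous fun t => ∫ s in t..t + ε, ‖γ' s‖ := by
    have hc := intervalIntegral.continuous_primitive hgi 0
    have : (fun t => ∫ s in t..t + ε, ‖γ' s‖) =
        fun t => (∫ s in (0 : ℝ)..t + ε, ‖γ' s‖) - ∫ s in (0 : ℝ)..t, ‖γ' s‖ := funext fun t =>
      (intervalIntegral.integral_interval_sub_left (hgi _ _) (hgi _ _)).symm
    rw [this]
    exact (hc.comp (continuous_add_const ε)).sub hc
  calc loopLength (r ∘ m)
      ≤ ∫ t in (0 : ℝ)..(2 * π), (1 + η) * ε⁻¹ * ∫ s in t..t + ε, ‖γ' s‖ :=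
        intervalIntegral.integral_mono_on hπ.le
          ((hβC1.continuous_deriv le_rfl).norm.intervalIntegrable _ _)
          ((continuous_const.mul hGc).intervalIntegrable _ _) fun t _ => hderiv t
    _ = (1 + η) * ∫ t in (0 : ℝ)..(2 * π), ‖γ' t‖ := by
        rw [intervalIntegral.integral_const_mul,
          Function.Periodic.integral_integral_shift (fun t => by rw [hγ'p t]) hgi]
        field_simp

theorem sq_integral_le_mul_integral_sq {g : ℝ → ℝ} {a b : ℝ} (hab : a < b)
    (hg : IntervalIntegrable g volume a b)
    (hg2 : IntervalIntegrable (fun t => g t ^ 2) volume a b) :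
    (∫ t in a..b, g t) ^ 2 ≤ (b - a) * ∫ t in a..b, g t ^ 2 := by
  set I := ∫ t in a..b, g t with hI
  have hba : 0 < b - a := sub_pos.2 hab
  have h0 : 0 ≤ ∫ t in a..b, ((b - a) * g t ^ 2 - 2 * I * g t) + I ^ 2 / (b - a) := by
    refine intervalIntegral.integral_nonneg hab.le fun t _ => ?_
    have : (b - a) * g t ^ 2 - 2 * I * g t + I ^ 2 / (b - a) =
        ((b - a) * g t - I) ^ 2 / (b - a) := by
      field_simp
      ring
    rw [this]
    positivity
  rw [intervalIntegral.integral_add ((hg2.const_mul _).sub (hg.const_mul _)) (by simp),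
    intervalIntegral.integral_sub (hg2.const_mul _) (hg.const_mul _),
    intervalIntegral.integral_const_mul, intervalIntegral.integral_const_mul, ← hI,
    intervalIntegral.integral_const, smul_eq_mul, mul_div_cancel₀ _ hba.ne'] at h0
  nlinarith

theorem minLength_sq_le_lintegral_circle {ν : ℕ} {N U : Set (EuclideanSpace ℝ (Fin ν))}
    (hN : IsCompact N) (hU : IsOpen U) (hNU : N ⊆ U)
    {r : EuclideanSpace ℝ (Fin ν) → EuclideanSpace ℝ (Fin ν)}
    (hr : ContDiffOn ℝ 1 r U) (hrN : ∀ x ∈ U, r x ∈ N) (hrid : ∀ x ∈ N, r x = x)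
    {v : ℂ → EuclideanSpace ℝ (Fin ν)} {a : ℂ} {R : ℝ} (hR : 0 < R)
    (hvN : ∀ t, v (circleMap a R t) ∈ N)
    (hvd : ∀ t, DifferentiableAt ℝ v (circleMap a R t)) :
    ENNReal.ofReal (minLength N (fun t => v (circleMap a R t)) ^ 2 / (4 * π)) ≤
      ENNReal.ofReal (R ^ 2) * ∫⁻ t in Set.Ioo (-π) π,
        ENNReal.ofReal (‖fderiv ℝ v (circleMap a R t)‖ ^ 2 / 2) := by
  set γ : ℝ → EuclideanSpace ℝ (Fin ν) := fun t => v (circleMap a R t) with hγ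
  set g : ℝ → ℝ := fun t => ‖fderiv ℝ v (circleMap a R t)‖ with hg
  have hgm : Measurable g :=
    (measurable_fderiv ℝ v).norm.comp (continuous_circleMap a R).measurable
  by_cases hfin : ∫⁻ t in Set.Ioo (-π) π, ENNReal.ofReal (g t ^ 2 / 2) = ⊤
  · rw [hfin, ENNReal.mul_top (by simpa using hR.ne')]
    exact le_top
  have hππ : -π < π := by linarith [Real.pi_pos]
  have hg2' : IntegrableOn (fun t => g t ^ 2 / 2) (Set.Ioo (-π) π) := by
    refine ⟨by fun_prop, ?_⟩
    rw [hasFiniteIntegral_iff_ofReal (Filter.Eventually.of_forall fun t => by positivity)]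
    exact lt_top_iff_ne_top.2 hfin
  have hg2 : IntervalIntegrable (fun t => g t ^ 2) volume (-π) π := by
    rw [intervalIntegrable_iff_integrableOn_Ioo_of_le hππ.le]
    simpa [IntegrableOn] using hg2'.mul_const 2
  have hg1 : IntervalIntegrable g volume (-π) π := by
    refine (hg2.add (intervalIntegrable_const (c := (1 : ℝ)))).mono_fun
      hgm.aestronglyMeasurable (Filter.Eventually.of_forall fun t => ?_)
    change |g t| ≤ |g t ^ 2 + 1|
    rw [abs_of_nonneg (norm_nonneg _), abs_of_nonneg (by positivity)]
    nlinarith [sq_nonneg (g t - 1)]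
  have hd : ∀ t, HasDerivAt γ (deriv γ t) t ∧ ‖deriv γ t‖ ≤ R * g t := fun t => by
    have h := (hvd t).hasFDerivAt.comp_hasDerivAt t (hasDerivAt_circleMap a R t)
    refine ⟨h.differentiableAt.hasDerivAt, ?_⟩
    rw [show deriv γ t = _ from h.deriv]
    refine (ContinuousLinearMap.le_opNorm _ _).trans_eq ?_
    rw [norm_mul, norm_circleMap_zero, Complex.norm_I, mul_one, abs_of_pos hR, mul_comm]
  have hγp : Function.Periodic γ (2 * π) := fun t => congrArg v (periodic_circleMap a R t)
  have hγc : Continuous γ := continuous_iff_continuousAt.2 fun t => (hd t).1.continuousAt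
  have hi : IntervalIntegrable (deriv γ) volume (-π) π := by
    refine (hg1.const_mul R).mono_fun (measurable_deriv γ).aestronglyMeasurable
      (Filter.Eventually.of_forall fun t => (hd t).2.trans (le_abs_self _))
  have hγ'p : Function.Periodic (deriv γ) (2 * π) := fun t => by
    have h := ((hd (t + 2 * π)).1).comp_add_const t (2 * π)
    rw [funext hγp] at h
    exact h.unique (hd t).1
  have hi0 : IntervalIntegrable (deriv γ) volume 0 (2 * π) := by
    refine hγ'p.intervalIntegrable (t := -π) (by positivity) ?_ _ _
    rwa [show -π + 2 * π = π by ring]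
  have hL : minLength N γ ≤ R * ∫ t in (-π)..π, g t := by
    refine (minLength_le_of_hasDerivAt hN hU hNU hr hrN hrid ⟨hγc, hγp, hvN⟩
      (fun t => (hd t).1) hi0).trans ?_
    have hp : Function.Periodic (fun t => ‖deriv γ t‖) (2 * π) := fun t => by
      simp only [hγ'p t]
    have h := hp.intervalIntegral_add_eq 0 (-π)
    rw [zero_add, show -π + 2 * π = π by ring] at h
    rw [h, ← intervalIntegral.integral_const_mul]
    exact intervalIntegral.integral_mono_on hππ.le hi.norm (hg1.const_mul _)
      fun t _ => (hd t).2
  rw [← ofReal_integral_eq_lintegral_ofReal hg2'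
    (Filter.Eventually.of_forall fun t => by positivity), ← ENNReal.ofReal_mul (by positivity)]
  apply ENNReal.ofReal_le_ofReal
  rw [← integral_Ioc_eq_integral_Ioo, ← intervalIntegral.integral_of_le hππ.le,
    intervalIntegral.integral_div, div_le_iff₀ (by positivity)]
  have hCS := sq_integral_le_mul_integral_sq hππ hg1 hg2
  calc minLength N γ ^ 2 ≤ (R * ∫ t in (-π)..π, g t) ^ 2 := by
        gcongr
        exact minLength_nonneg N γ
    _ = R ^ 2 * (∫ t in (-π)..π, g t) ^ 2 := by ring
    _ ≤ R ^ 2 * ((π - -π) * ∫ t in (-π)..π, g t ^ 2) := by gcongr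
    _ = _ := by ring

theorem singularEnergy_nonneg {ν : ℕ} (N : Set (EuclideanSpace ℝ (Fin ν))) (Ω : Set ℂ)
    (g : ℂ → EuclideanSpace ℝ (Fin ν)) : 0 ≤ singularEnergy N Ω g := by
  apply Real.sInf_nonneg
  rintro _ ⟨k, -, γs, -, -, rfl⟩
  positivity

theorem singularEnergy_le_sum {ν : ℕ} {N : Set (EuclideanSpace ℝ (Fin ν))} {Ω : Set ℂ}
    {g : ℂ → EuclideanSpace ℝ (Fin ν)} {k : ℕ} (hk : 1 ≤ k)
    {γs : Fin k → ℝ → EuclideanSpace ℝ (Fin ν)} (hγs : ∀ i, IsLoopIn N (γs i))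
    (h : TopResolution N Ω g γs) :
    singularEnergy N Ω g ≤ ∑ i, minLength N (γs i) ^ 2 / (4 * π) := by
  apply csInf_le
  · refine ⟨0, ?_⟩
    rintro _ ⟨k, -, γs, -, -, rfl⟩
    positivity
  · exact ⟨k, hk, γs, hγs, h, rfl⟩

/-- The map that pushes each punctured disk `B_{R i}(a i)` radially onto its boundary circle
and fixes the complement of the disks. -/
noncomputable def radialPush {k : ℕ} (a : Fin k → ℂ) (R : Fin k → ℝ) (x : ℂ) : ℂ :=
  x + ∑ i, ((max (R i / ‖x - a i‖ - 1) 0 : ℝ) : ℂ) * (x - a i)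

theorem radialPush_summand_eq_zero {a x : ℂ} {R : ℝ} (hR : 0 < R) (hx : x ∉ ball a R) :
    ((max (R / ‖x - a‖ - 1) 0 : ℝ) : ℂ) * (x - a) = 0 := by
  rw [mem_ball, not_lt, dist_eq_norm] at hx
  rw [max_eq_right, Complex.ofReal_zero, zero_mul]
  rw [sub_nonpos]
  exact (div_le_one (hR.trans_le hx)).2 hx

theorem radialPush_of_notMem {k : ℕ} {a : Fin k → ℂ} {R : Fin k → ℝ} (hR : ∀ i, 0 < R i) {x : ℂ}
    (hx : ∀ i, x ∉ ball (a i) (R i)) : radialPush a R x = x := by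
  rw [radialPush, Finset.sum_eq_zero fun i _ => radialPush_summand_eq_zero (hR i) (hx i), add_zero]

theorem radialPush_of_mem {k : ℕ} {a : Fin k → ℂ} {R : Fin k → ℝ} (hR : ∀ i, 0 < R i)
    (hdisj : ∀ i j, i ≠ j → Disjoint (closedBall (a i) (R i)) (closedBall (a j) (R j)))
    {x : ℂ} {j : Fin k} (hx : x ∈ closedBall (a j) (R j)) (hxa : x ≠ a j) :
    radialPush a R x = a j + ((R j / ‖x - a j‖ : ℝ) : ℂ) * (x - a j) := by
  have h0 : 0 < ‖x - a j‖ := norm_pos_iff.2 (sub_ne_zero.2 hxa)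
  rw [radialPush, Finset.sum_eq_single j, max_eq_left]
  · push_cast
    ring
  · rw [sub_nonneg, one_le_div h0]
    simpa [dist_eq_norm] using hx
  · intro i _ hij
    refine radialPush_summand_eq_zero (hR i) fun hxi => ?_
    exact (hdisj i j hij).le_bot ⟨ball_subset_closedBall hxi, hx⟩
  · simp

theorem sphere_subset_closure_diff_balls {ι : Type*} {Ω : Set ℂ} {a : ι → ℂ} {R : ι → ℝ}
    (hdisj : ∀ i j, i ≠ j → Disjoint (closedBall (a i) (R i)) (closedBall (a j) (R j)))
    (hsub : ∀ i, closedBall (a i) (R i) ⊆ Ω) (j : ι) :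
    sphere (a j) (R j) ⊆ closure Ω \ ⋃ i, ball (a i) (R i) := by
  intro x hx
  refine ⟨subset_closure (hsub j (sphere_subset_closedBall hx)), ?_⟩
  rw [Set.mem_iUnion]
  rintro ⟨i, hi⟩
  by_cases hij : i = j
  · subst hij
    exact (mem_ball.1 hi).ne (mem_sphere.1 hx)
  · exact (hdisj i j hij).le_bot ⟨ball_subset_closedBall hi, sphere_subset_closedBall hx⟩

theorem topResolution_of_disjoint_closedBalls {ν : ℕ} {N : Set (EuclideanSpace ℝ (Fin ν))}
    {Ω : Set ℂ} (hΩ : IsOpen Ω) {v : ℂ → EuclideanSpace ℝ (Fin ν)} {k : ℕ} (hk : 1 ≤ k)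
    {a : Fin k → ℂ} {R : Fin k → ℝ} (hR : ∀ i, 0 < R i)
    (hdisj : ∀ i j, i ≠ j → Disjoint (closedBall (a i) (R i)) (closedBall (a j) (R j)))
    (hsub : ∀ i, closedBall (a i) (R i) ⊆ Ω)
    (hvc : ContinuousOn v (closure Ω \ ⋃ i, ball (a i) (R i)))
    (hvN : ∀ x ∈ closure Ω \ ⋃ i, ball (a i) (R i), v x ∈ N) :
    TopResolution N Ω v (fun i t => v (circleMap (a i) (R i) t)) := by
  have : Nonempty (Fin k) := ⟨⟨0, hk⟩⟩
  obtain ⟨i₀, hi₀⟩ := Finite.exists_min R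
  have hcirc := sphere_subset_closure_diff_balls hdisj hsub
  have hne : ∀ x ∈ closure Ω \ ⋃ i, ball (a i) (R i₀), ∀ j, x ≠ a j := by
    rintro x ⟨-, hx⟩ j rfl
    exact hx (Set.mem_iUnion.2 ⟨j, mem_ball_self (hR i₀)⟩)
  have hmaps : Set.MapsTo (radialPush a R) (closure Ω \ ⋃ i, ball (a i) (R i₀))
      (closure Ω \ ⋃ i, ball (a i) (R i)) := by
    intro x hx
    by_cases hj : ∃ j, x ∈ closedBall (a j) (R j)
    · obtain ⟨j, hj⟩ := hj
      apply hcirc j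
      have h0 : 0 < ‖x - a j‖ := norm_pos_iff.2 (sub_ne_zero.2 (hne x hx j))
      rw [radialPush_of_mem hR hdisj hj (hne x hx j), mem_sphere, dist_eq_norm,
        add_sub_cancel_left, norm_mul, Complex.norm_real, Real.norm_eq_abs,
        abs_of_pos (div_pos (hR j) h0)]
      field_simp
    · push Not at hj
      have hj' : ∀ i, x ∉ ball (a i) (R i) := fun i hi => hj i (ball_subset_closedBall hi)
      rw [radialPush_of_notMem hR hj']
      exact ⟨hx.1, by simpa using hj'⟩
  have hcont : ContinuousOn (radialPush a R) (closure Ω \ ⋃ i, ball (a i) (R i₀)) := by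
    unfold radialPush
    refine continuousOn_id.add
      (continuousOn_finsetSum _ fun i _ => ContinuousOn.mul ?_ (by fun_prop))
    refine Complex.continuous_ofReal.comp_continuousOn ?_
    refine ContinuousOn.sup ?_ continuousOn_const
    refine (ContinuousOn.div continuousOn_const (by fun_prop) fun x hx => ?_).sub continuousOn_const
    exact norm_ne_zero_iff.2 (sub_ne_zero.2 (hne x hx i))
  have hfr : ∀ x ∈ frontier Ω, ∀ i, x ∉ ball (a i) (R i) := fun x hx i hi => by
    rw [hΩ.frontier_eq] at hx
    exact hx.2 (hsub i (ball_subset_closedBall hi))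
  have hfr' : ∀ x ∈ frontier Ω, x ∈ closure Ω \ ⋃ i, ball (a i) (R i) := fun x hx =>
    ⟨frontier_subset_closure hx, by simpa using hfr x hx⟩
  have hpush : ∀ i t, radialPush a R (circleMap (a i) (R i₀) t) = circleMap (a i) (R i) t := by
    intro i t
    rw [radialPush_of_mem hR hdisj (j := i)]
    · simp only [circleMap_sub_center, norm_circleMap_zero, abs_of_pos (hR i₀)]
      simp only [circleMap, Complex.ofReal_div, zero_add]
      rw [← mul_assoc, div_mul_cancel₀ _ (Complex.ofReal_ne_zero.2 (hR i₀).ne')]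
    · exact closedBall_subset_closedBall (hi₀ i) (circleMap_mem_closedBall _ (hR i₀).le _)
    · exact circleMap_ne_center (hR i₀).ne'
  refine ⟨a, R i₀, hR i₀, fun i => (closedBall_subset_closedBall (hi₀ i)).trans (hsub i),
    fun i j hij => (hdisj i j hij).mono (closedBall_subset_closedBall (hi₀ i))
      (closedBall_subset_closedBall (hi₀ j)),
    v ∘ radialPush a R, hvc.comp hcont hmaps, fun x hx => hvN _ (hmaps hx), ?_, fun i => ?_⟩
  · refine ⟨fun p => v p.2, ?_, fun x => ?_, fun x => rfl, fun p => hvN _ (hfr' _ p.2.2)⟩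
    · exact hvc.comp_continuous (continuous_subtype_val.comp continuous_snd) fun p => hfr' _ p.2.2
    · simp only [Function.comp, radialPush_of_notMem hR (hfr _ x.2)]
  · refine ⟨fun p => v (circleMap (a i) (R i) p.2), ?_, fun t => ?_, fun t => rfl, fun p => ?_,
      fun s t => ?_⟩
    · exact hvc.comp_continuous ((continuous_circleMap _ _).comp continuous_snd) fun p =>
        hcirc i (circleMap_mem_sphere _ (hR i).le _)
    · exact congrArg v (hpush i t).symm
    · exact hvN _ (hcirc i (circleMap_mem_sphere _ (hR i).le _))
    · exact congrArg v (periodic_circleMap _ _ t)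

theorem singularEnergy_le_sum_circles {ν : ℕ} {N : Set (EuclideanSpace ℝ (Fin ν))}
    {Ω : Set ℂ} (hΩ : IsOpen Ω) {v : ℂ → EuclideanSpace ℝ (Fin ν)} {F : Finset (ℂ × ℝ)}
    (hF : F.Nonempty) {c : ℝ} (hR : ∀ p ∈ F, 0 < c * p.2)
    (hdisj : ∀ p ∈ F, ∀ q ∈ F, p ≠ q →
      Disjoint (closedBall p.1 (c * p.2)) (closedBall q.1 (c * q.2)))
    (hsub : ∀ p ∈ F, closedBall p.1 (c * p.2) ⊆ Ω)
    (hvc : ContinuousOn v (closure Ω \ ⋃ p ∈ F, ball p.1 (c * p.2)))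
    (hvN : ∀ x ∈ closure Ω \ ⋃ p ∈ F, ball p.1 (c * p.2), v x ∈ N) :
    singularEnergy N Ω v ≤
      ∑ p ∈ F, minLength N (fun t => v (circleMap p.1 (c * p.2) t)) ^ 2 / (4 * π) := by
  set e := F.equivFin.symm
  have hU : (⋃ i, ball (e i).1.1 (c * (e i).1.2)) = ⋃ p ∈ F, ball p.1 (c * p.2) := by
    rw [Set.iUnion_congr_of_surjective (g := fun p : F => ball p.1.1 (c * p.1.2)) e e.surjective
      fun _ => rfl, Set.iUnion_subtype]
  rw [← hU] at hvc hvN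
  have hd : ∀ i j, i ≠ j → Disjoint (closedBall (e i).1.1 (c * (e i).1.2))
      (closedBall (e j).1.1 (c * (e j).1.2)) := fun i j hij =>
    hdisj _ (e i).2 _ (e j).2 fun h => hij (e.injective (Subtype.ext h))
  have hmem : ∀ i t, circleMap (e i).1.1 (c * (e i).1.2) t ∈
      closure Ω \ ⋃ i, ball (e i).1.1 (c * (e i).1.2) := fun i t =>
    sphere_subset_closure_diff_balls hd (fun i => hsub _ (e i).2) i
      (circleMap_mem_sphere _ (hR _ (e i).2).le t)
  refine (singularEnergy_le_sum (Finset.card_pos.2 hF) (fun i => ⟨?_, ?_, ?_⟩)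
    (topResolution_of_disjoint_closedBalls hΩ (Finset.card_pos.2 hF)
      (a := fun i => (e i).1.1) (R := fun i => c * (e i).1.2)
      (fun i => hR _ (e i).2) hd (fun i => hsub _ (e i).2) hvc hvN)).trans_eq ?_
  · exact hvc.comp_continuous (continuous_circleMap _ _) (hmem i)
  · exact fun t => congrArg v (periodic_circleMap _ _ t)
  · exact fun t => hvN _ (hmem i t)
  · rw [e.sum_comp fun p : F => minLength N (fun t => v (circleMap p.1.1 (c * p.1.2) t)) ^ 2 /
      (4 * π), Finset.sum_coe_sort F fun p =>
        minLength N (fun t => v (circleMap p.1 (c * p.2) t)) ^ 2 / (4 * π)]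

theorem lintegral_comp_const_smul_complex {f : ℂ → ℝ≥0∞} (hf : Measurable f) {r : ℝ} (hr : 0 < r) :
    ∫⁻ x, f x = ENNReal.ofReal (r ^ 2) * ∫⁻ y, f (r • y) := by
  have h := lintegral_map (μ := volume) hf (measurable_const_smul r (α := ℂ))
  rw [Measure.map_addHaar_smul volume hr.ne', lintegral_smul_measure, Complex.finrank_real_complex,
    abs_of_pos (by positivity)] at h
  rw [← h, smul_eq_mul, ← mul_assoc, ← ENNReal.ofReal_mul (by positivity),
    mul_inv_cancel₀ (by positivity), ENNReal.ofReal_one, one_mul]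

theorem measurable_circleMap_uncurried (a : ℂ) (r : ℝ) :
    Measurable fun p : ℝ × ℝ => circleMap a (p.1 * r) p.2 := by
  unfold circleMap
  fun_prop

theorem lintegral_annulus_eq {f : ℂ → ℝ≥0∞} (hf : Measurable f) (a : ℂ) {r : ℝ} (hr : 0 < r)
    (Λ : ℝ) :
    ∫⁻ x in ball a (Λ * r) \ closedBall a r, f x =
      ∫⁻ c in Set.Ioo 1 Λ, ENNReal.ofReal (c * r ^ 2) *
        ∫⁻ θ in Set.Ioo (-π) π, f (circleMap a (c * r) θ) := by
  have hS : MeasurableSet (ball a (Λ * r) \ closedBall a r) :=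
    measurableSet_ball.diff measurableSet_closedBall
  have hfa : Measurable fun x => (ball a (Λ * r) \ closedBall a r).indicator f (a + x) :=
    (hf.indicator hS).comp (measurable_const_add a)
  have hfm : Measurable fun p : ℝ × ℝ => f (circleMap a (p.1 * r) p.2) :=
    hf.comp (measurable_circleMap_uncurried a r)
  rw [← lintegral_indicator hS, ← lintegral_add_left_eq_self _ a,
    lintegral_comp_const_smul_complex hfa hr, ← Complex.lintegral_comp_polarCoord_symm]
  have hpt : ∀ p ∈ polarCoord.target, ENNReal.ofReal p.1 •
      (ball a (Λ * r) \ closedBall a r).indicator f (a + r • Complex.polarCoord.symm p) =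
      (Set.Ioo 1 Λ ×ˢ Set.univ).indicator
        (fun p => ENNReal.ofReal p.1 * f (circleMap a (p.1 * r) p.2)) p := by
    rintro ⟨c, θ⟩ ⟨hc, -⟩
    have hc0 : (0 : ℝ) < c := hc
    have hcm : a + r • Complex.polarCoord.symm (c, θ) = circleMap a (c * r) θ := by
      rw [circleMap, Complex.exp_mul_I, Complex.polarCoord_symm_apply, Complex.real_smul]
      push_cast
      ring
    have hmem : circleMap a (c * r) θ ∈ ball a (Λ * r) \ closedBall a r ↔
        (c, θ) ∈ Set.Ioo 1 Λ ×ˢ (Set.univ : Set ℝ) := by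
      rw [Set.mem_sdiff, mem_ball, mem_closedBall, dist_eq_norm, circleMap_sub_center,
        norm_circleMap_zero, abs_of_pos (mul_pos hc0 hr)]
      simp [hr, and_comm]
    rw [hcm]
    by_cases h : circleMap a (c * r) θ ∈ ball a (Λ * r) \ closedBall a r
    · rw [Set.indicator_of_mem h, Set.indicator_of_mem (hmem.1 h), smul_eq_mul]
    · rw [Set.indicator_of_notMem h, Set.indicator_of_notMem (fun h' => h (hmem.2 h')), smul_zero]
  have htarget : polarCoord.target = Set.Ioi (0 : ℝ) ×ˢ Set.Ioo (-π) π := rfl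
  have hinter : (Set.Ioo 1 Λ ×ˢ (Set.univ : Set ℝ)) ∩ (Set.Ioi (0 : ℝ) ×ˢ Set.Ioo (-π) π) =
      Set.Ioo 1 Λ ×ˢ Set.Ioo (-π) π := by
    rw [Set.prod_inter_prod, Set.univ_inter, Set.inter_eq_left.2]
    exact fun c hc => zero_lt_one.trans hc.1
  rw [setLIntegral_congr_fun (htarget ▸ measurableSet_Ioi.prod measurableSet_Ioo) hpt, htarget,
    setLIntegral_indicator (measurableSet_Ioo.prod MeasurableSet.univ), hinter,
    Measure.volume_eq_prod, ← Measure.prod_restrict,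
    lintegral_prod _ (by fun_prop), ← lintegral_const_mul _ (by
      refine Measurable.lintegral_prod_right' (f := fun p : ℝ × ℝ =>
        ENNReal.ofReal p.1 * f (circleMap a (p.1 * r) p.2)) (by fun_prop))]
  refine setLIntegral_congr_fun measurableSet_Ioo fun c hc => ?_
  simp only
  rw [lintegral_const_mul _ (by fun_prop), ← mul_assoc, ← ENNReal.ofReal_mul (by positivity),
    mul_comm (r ^ 2)]

theorem ofReal_mul_log_eq_lintegral (E : ℝ) {Λ : ℝ} (hΛ : 1 ≤ Λ) :
    ENNReal.ofReal (E * Real.log Λ) =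
      ∫⁻ c in Set.Ioo 1 Λ, ENNReal.ofReal c⁻¹ * ENNReal.ofReal E := by
  have hi : IntervalIntegrable (fun c : ℝ => c⁻¹) volume 1 Λ :=
    intervalIntegral.intervalIntegrable_inv (fun x hx => by
      rw [Set.uIcc_of_le hΛ] at hx
      linarith [hx.1]) continuousOn_id
  rw [intervalIntegrable_iff_integrableOn_Ioo_of_le hΛ] at hi
  rw [lintegral_mul_const _ (by fun_prop), ← ofReal_integral_eq_lintegral_ofReal hi,
    ← integral_Ioc_eq_integral_Ioo, ← intervalIntegral.integral_of_le hΛ,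
    integral_inv_of_pos one_pos (by linarith), div_one, ← ENNReal.ofReal_mul
      (Real.log_nonneg hΛ), mul_comm]
  filter_upwards [ae_restrict_mem measurableSet_Ioo] with c hc
  exact inv_nonneg.2 (zero_le_one.trans hc.1.le)

/-- Lower bound for the energy on disjoint annuli from lower bounds on concentric circles. -/
theorem ofReal_mul_log_le_lintegral_annuli {f : ℂ → ℝ≥0∞} (hf : Measurable f) {E Λ : ℝ}
    (hΛ : 1 ≤ Λ) {F : Finset (ℂ × ℝ)} (hpos : ∀ p ∈ F, 0 < p.2)
    (hdisj : ∀ p ∈ F, ∀ q ∈ F, p ≠ q → Λ * (p.2 + q.2) ≤ dist p.1 q.1)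
    (hcirc : ∀ c, 1 < c → c < Λ → ENNReal.ofReal E ≤ ∑ p ∈ F, ENNReal.ofReal ((c * p.2) ^ 2) *
      ∫⁻ θ in Set.Ioo (-π) π, f (circleMap p.1 (c * p.2) θ)) :
    ENNReal.ofReal (E * Real.log Λ) ≤
      ∫⁻ x in ⋃ p ∈ F, (ball p.1 (Λ * p.2) \ closedBall p.1 p.2), f x := by
  have hm : ∀ p : ℂ × ℝ, Measurable fun c : ℝ => ENNReal.ofReal (c * p.2 ^ 2) *
      ∫⁻ θ in Set.Ioo (-π) π, f (circleMap p.1 (c * p.2) θ) := fun p => by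
    have := Measurable.lintegral_prod_right' (ν := volume.restrict (Set.Ioo (-π) π))
      (hf.comp (measurable_circleMap_uncurried p.1 p.2))
    exact Measurable.mul (by fun_prop) this
  rw [lintegral_biUnion_finset]
  · rw [ofReal_mul_log_eq_lintegral E hΛ,
      Finset.sum_congr rfl fun p hp => lintegral_annulus_eq hf p.1 (hpos p hp) Λ,
      ← lintegral_finsetSum _ fun p _ => hm p]
    refine setLIntegral_mono' measurableSet_Ioo fun c hc => ?_
    have hc0 : 0 < c := zero_lt_one.trans hc.1
    refine (mul_le_mul_right (hcirc c hc.1 hc.2) _).trans_eq ?_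
    rw [Finset.mul_sum]
    refine Finset.sum_congr rfl fun p _ => ?_
    rw [← mul_assoc, ← ENNReal.ofReal_mul (by positivity)]
    congr 2
    field_simp
  · intro p hp q hq hpq
    refine Disjoint.mono Set.sdiff_subset Set.sdiff_subset (ball_disjoint_ball ?_)
    rw [← mul_add]
    exact hdisj p hp q hq hpq
  · exact fun p _ => measurableSet_ball.diff measurableSet_closedBall

/-- A finite nonempty family of closed disks of positive radii that covers `K`, each disk of which
meets `K`. -/
structure IsDiskCover (K : Set ℂ) (F : Finset (ℂ × ℝ)) : Prop where
  nonempty : F.Nonempty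
  pos : ∀ p ∈ F, 0 < p.2
  meets : ∀ p ∈ F, (closedBall p.1 p.2 ∩ K).Nonempty
  cover : K ⊆ ⋃ p ∈ F, closedBall p.1 p.2

/-- The disks of a family scaled by the factor `c` about their centres. -/
noncomputable def scaleDisks (c : ℝ) (F : Finset (ℂ × ℝ)) : Finset (ℂ × ℝ) :=
  F.image fun p => (p.1, c * p.2)

theorem injective_scale_radius {c : ℝ} (hc : c ≠ 0) :
    Function.Injective fun p : ℂ × ℝ => (p.1, c * p.2) := fun p q h => by
  simp only [Prod.mk.injEq, mul_eq_mul_left_iff, hc, or_false] at h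
  exact Prod.ext h.1 h.2

theorem sum_scaleDisks {c : ℝ} (hc : c ≠ 0) (F : Finset (ℂ × ℝ)) :
    ∑ p ∈ scaleDisks c F, p.2 = c * ∑ p ∈ F, p.2 := by
  rw [scaleDisks, Finset.sum_image (injective_scale_radius hc).injOn, Finset.mul_sum]

theorem iUnion_scaleDisks (c : ℝ) (F : Finset (ℂ × ℝ)) :
    ⋃ p ∈ scaleDisks c F, closedBall p.1 p.2 = ⋃ p ∈ F, closedBall p.1 (c * p.2) := by
  simp only [scaleDisks, Finset.set_biUnion_finset_image]

theorem closedBall_subset_closedBall_mul (a : ℂ) {c r : ℝ} (hc : 1 ≤ c) (hr : 0 ≤ r) :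
    closedBall a r ⊆ closedBall a (c * r) :=
  closedBall_subset_closedBall (by nlinarith)

theorem IsDiskCover.scale {K : Set ℂ} {F : Finset (ℂ × ℝ)} (h : IsDiskCover K F) {c : ℝ}
    (hc : 1 ≤ c) : IsDiskCover K (scaleDisks c F) where
  nonempty := h.nonempty.image _
  pos := by
    intro p hp
    obtain ⟨q, hq, rfl⟩ := Finset.mem_image.1 hp
    exact mul_pos (by linarith) (h.pos q hq)
  meets := by
    intro p hp
    obtain ⟨q, hq, rfl⟩ := Finset.mem_image.1 hp
    exact (h.meets q hq).mono (Set.inter_subset_inter_left _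
      (closedBall_subset_closedBall_mul _ hc (h.pos q hq).le))
  cover := by
    rw [iUnion_scaleDisks]
    exact h.cover.trans (Set.iUnion₂_mono fun p hp =>
      closedBall_subset_closedBall_mul _ hc (h.pos p hp).le)

theorem exists_closedBall_union_subset {a b : ℂ} {r s : ℝ} (hr : 0 < r) (hs : 0 < s)
    (h : dist a b ≤ r + s) :
    ∃ c, closedBall a r ⊆ closedBall c (r + s) ∧ closedBall b s ⊆ closedBall c (r + s) := by
  have hrs : 0 < r + s := add_pos hr hs
  refine ⟨AffineMap.lineMap a b (s / (r + s)), closedBall_subset_closedBall' ?_,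
    closedBall_subset_closedBall' ?_⟩
  · rw [dist_left_lineMap, Real.norm_eq_abs, abs_of_pos (by positivity)]
    have : s / (r + s) * dist a b ≤ s / (r + s) * (r + s) := by gcongr
    rw [div_mul_cancel₀ _ hrs.ne'] at this
    linarith
  · rw [dist_comm, dist_lineMap_right, Real.norm_eq_abs,
      show 1 - s / (r + s) = r / (r + s) by field_simp; ring, abs_of_pos (by positivity)]
    have : r / (r + s) * dist a b ≤ r / (r + s) * (r + s) := by gcongr
    rw [div_mul_cancel₀ _ hrs.ne'] at this
    linarith

/-- Two intersecting disks of a cover can be replaced by one disk without increasing the sum of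
the radii. -/
theorem IsDiskCover.exists_merge {K : Set ℂ} {F : Finset (ℂ × ℝ)} (h : IsDiskCover K F)
    {p q : ℂ × ℝ} (hp : p ∈ F) (hq : q ∈ F) (hpq : p ≠ q) (hd : dist p.1 q.1 ≤ p.2 + q.2) :
    ∃ F', IsDiskCover K F' ∧ F'.card < F.card ∧ ∑ x ∈ F', x.2 ≤ ∑ x ∈ F, x.2 ∧
      ⋃ x ∈ F, closedBall x.1 x.2 ⊆ ⋃ x ∈ F', closedBall x.1 x.2 := by
  obtain ⟨c, hcp, hcq⟩ := exists_closedBall_union_subset (h.pos p hp) (h.pos q hq) hd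
  have hq' : q ∈ F.erase p := Finset.mem_erase.2 ⟨hpq.symm, hq⟩
  set G := (F.erase p).erase q with hG
  have hGF : G ⊆ F := (Finset.erase_subset _ _).trans (Finset.erase_subset _ _)
  have hmem : ∀ x ∈ insert (c, p.2 + q.2) G, closedBall x.1 x.2 ⊆
      ⋃ x ∈ insert (c, p.2 + q.2) G, closedBall x.1 x.2 := fun x hx =>
    Set.subset_iUnion₂ (s := fun (x : ℂ × ℝ) (_ : x ∈ insert (c, p.2 + q.2) G) =>
      closedBall x.1 x.2) x hx
  have hU : ⋃ x ∈ F, closedBall x.1 x.2 ⊆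
      ⋃ x ∈ insert (c, p.2 + q.2) G, closedBall x.1 x.2 := by
    refine Set.iUnion₂_subset fun x hx => ?_
    by_cases hxp : x = p
    · subst hxp
      exact hcp.trans (hmem _ (Finset.mem_insert_self _ _))
    by_cases hxq : x = q
    · subst hxq
      exact hcq.trans (hmem _ (Finset.mem_insert_self _ _))
    · exact hmem _
        (Finset.mem_insert_of_mem (Finset.mem_erase.2 ⟨hxq, Finset.mem_erase.2 ⟨hxp, hx⟩⟩))
  have hcard : G.card + 2 = F.card := by
    have h1 := Finset.card_erase_add_one hp
    have h2 : G.card + 1 = (F.erase p).card := Finset.card_erase_add_one hq'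
    omega
  have hsum : ∑ x ∈ G, x.2 + q.2 + p.2 = ∑ x ∈ F, x.2 := by
    rw [hG, Finset.sum_erase_add _ _ hq', Finset.sum_erase_add _ _ hp]
  have hnew : 0 < p.2 + q.2 := add_pos (h.pos p hp) (h.pos q hq)
  refine ⟨insert (c, p.2 + q.2) G, ⟨Finset.insert_nonempty _ _, ?_, ?_, h.cover.trans hU⟩,
    ?_, ?_, hU⟩
  · intro x hx
    rcases Finset.mem_insert.1 hx with rfl | hx
    · exact hnew
    · exact h.pos x (hGF hx)
  · intro x hx
    rcases Finset.mem_insert.1 hx with rfl | hx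
    · exact (h.meets p hp).mono (Set.inter_subset_inter_left _ hcp)
    · exact h.meets x (hGF hx)
  · exact (Finset.card_insert_le _ _).trans_lt (by omega)
  · by_cases hmem : (c, p.2 + q.2) ∈ G
    · rw [Finset.insert_eq_of_mem hmem]
      linarith
    · rw [Finset.sum_insert hmem]
      linarith

theorem closedBall_subset_of_meets {K Ω : Set ℂ} {d : ℝ} (hΩ : ∀ x ∈ K, ball x d ⊆ Ω) {a : ℂ}
    {r R : ℝ} (hm : (closedBall a r ∩ K).Nonempty) (hrR : r + R < d) :
    closedBall a R ⊆ Ω := by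
  obtain ⟨x, hx, hxK⟩ := hm
  intro y hy
  refine hΩ x hxK (mem_ball.2 ?_)
  rw [mem_closedBall] at hx hy
  linarith [dist_triangle_right y x a]

/-- Ball growth: lower bounds for `f` on the boundaries of disjoint families of disks covering
`K` integrate to a logarithmic lower bound outside any initial cover. -/
theorem ofReal_mul_log_le_lintegral_of_ball_growth {K Ω : Set ℂ} (hΩm : MeasurableSet Ω)
    {f : ℂ → ℝ≥0∞} (hf : Measurable f) {E S : ℝ} (hE : 0 ≤ E)
    (hS0 : 0 ≤ S) (hΩ : ∀ x ∈ K, ball x (2 * S) ⊆ Ω)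
    (hcirc : ∀ F, IsDiskCover K F → ∀ c, 1 < c → c * ∑ p ∈ F, p.2 < S →
      (∀ p ∈ F, ∀ q ∈ F, p ≠ q →
        Disjoint (closedBall p.1 (c * p.2)) (closedBall q.1 (c * q.2))) →
      ENNReal.ofReal E ≤ ∑ p ∈ F, ENNReal.ofReal ((c * p.2) ^ 2) *
        ∫⁻ θ in Set.Ioo (-π) π, f (circleMap p.1 (c * p.2) θ))
    {F : Finset (ℂ × ℝ)} (hF : IsDiskCover K F) {s : ℝ} (hs : 0 < s)
    (hFs : ∑ p ∈ F, p.2 ≤ s) :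
    ENNReal.ofReal (E * Real.log (S / s)) ≤
      ∫⁻ x in Ω \ ⋃ p ∈ F, closedBall p.1 p.2, f x := by
  induction hn : F.card using Nat.strong_induction_on generalizing F s with
  | _ n ih =>
  rcases le_or_gt (S / s) 1 with hS | hS
  · rw [ENNReal.ofReal_of_nonpos
      (mul_nonpos_of_nonneg_of_nonpos hE (Real.log_nonpos (div_nonneg hS0 hs.le) hS))]
    exact zero_le
  have hsS : s < S := by rwa [one_lt_div hs] at hS
  by_cases hmerge : ∃ p ∈ F, ∃ q ∈ F, p ≠ q ∧ dist p.1 q.1 ≤ p.2 + q.2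
  · obtain ⟨p, hp, q, hq, hpq, hd⟩ := hmerge
    obtain ⟨F', hF', hcard, hsum, hU⟩ := hF.exists_merge hp hq hpq hd
    exact (ih _ (hn ▸ hcard) hF' hs (hsum.trans hFs) rfl).trans
      (lintegral_mono_set (Set.sdiff_subset_sdiff_right hU))
  push Not at hmerge
  have hle : ∀ p ∈ F, p.2 ≤ s := fun p hp =>
    (Finset.single_le_sum (fun q hq => (hF.pos q hq).le) hp).trans hFs
  have hannuli : ∀ Λ, 1 < Λ → Λ ≤ S / s →
      (∀ p ∈ F, ∀ q ∈ F, p ≠ q → Λ * (p.2 + q.2) ≤ dist p.1 q.1) →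
      ENNReal.ofReal (E * Real.log Λ) ≤
        ∫⁻ x in ⋃ p ∈ F, (ball p.1 (Λ * p.2) \ closedBall p.1 p.2), f x ∧
      ⋃ p ∈ F, (ball p.1 (Λ * p.2) \ closedBall p.1 p.2) ⊆
        Ω \ ⋃ p ∈ F, closedBall p.1 p.2 := by
    intro Λ hΛ hΛS hΛd
    have hΛs : Λ * s ≤ S := by rwa [le_div_iff₀ hs] at hΛS
    constructor
    · refine ofReal_mul_log_le_lintegral_annuli hf hΛ.le hF.pos hΛd fun c hc hcΛ =>
        hcirc F hF c hc ?_ fun p hp q hq hpq => closedBall_disjoint_closedBall ?_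
      · calc c * ∑ p ∈ F, p.2 ≤ c * s := by gcongr
          _ < Λ * s := by gcongr
          _ ≤ S := hΛs
      · have := hΛd p hp q hq hpq
        nlinarith [hF.pos p hp, hF.pos q hq]
    · refine Set.iUnion₂_subset fun p hp x hx => ⟨?_, ?_⟩
      · obtain ⟨y, hy, hyK⟩ := hF.meets p hp
        refine hΩ y hyK (mem_ball.2 ?_)
        have h1 := mem_ball.1 hx.1
        rw [mem_closedBall] at hy
        have h2 : Λ * p.2 ≤ Λ * s := by
          have := hle p hp
          gcongr
        have h3 := hF.pos p hp
        nlinarith [dist_triangle_right x y p.1]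
      · rw [Set.mem_iUnion₂]
        rintro ⟨q, hq, hxq⟩
        by_cases hpq : p = q
        · subst hpq
          exact hx.2 hxq
        · have h1 := hΛd p hp q hq hpq
          have h2 := mem_ball.1 hx.1
          have h3 := mem_closedBall.1 hxq
          have h4 := dist_triangle_left p.1 q.1 x
          nlinarith [hF.pos q hq]
  by_cases hfinal : ∀ p ∈ F, ∀ q ∈ F, p ≠ q → S / s * (p.2 + q.2) ≤ dist p.1 q.1
  · obtain ⟨h1, h2⟩ := hannuli (S / s) hS le_rfl hfinal
    exact h1.trans (lintegral_mono_set h2)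
  push Not at hfinal
  obtain ⟨p₁, hp₁, q₁, hq₁, hpq₁, hd₁⟩ := hfinal
  obtain ⟨⟨p, q⟩, hpq, hmin⟩ := Finset.exists_min_image F.offDiag
    (fun x : (ℂ × ℝ) × (ℂ × ℝ) => dist x.1.1 x.2.1 / (x.1.2 + x.2.2))
    ⟨(p₁, q₁), Finset.mem_offDiag.2 ⟨hp₁, hq₁, hpq₁⟩⟩
  obtain ⟨hp, hq, hpq⟩ := Finset.mem_offDiag.1 hpq
  set Λ := dist p.1 q.1 / (p.2 + q.2) with hΛdef
  have hsumpos : ∀ p ∈ F, ∀ q ∈ F, 0 < p.2 + q.2 := fun p hp q hq =>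
    add_pos (hF.pos p hp) (hF.pos q hq)
  have hΛ1 : 1 < Λ := (one_lt_div (hsumpos p hp q hq)).2 (hmerge p hp q hq hpq)
  have hΛ0 : 0 < Λ := zero_lt_one.trans hΛ1
  have hΛS : Λ < S / s := (hmin (p₁, q₁) (Finset.mem_offDiag.2 ⟨hp₁, hq₁, hpq₁⟩)).trans_lt
    ((div_lt_iff₀ (hsumpos _ hp₁ _ hq₁)).2 hd₁)
  obtain ⟨hA, hAsub⟩ := hannuli Λ hΛ1 hΛS.le fun x hx y hy hxy =>
    (le_div_iff₀ (hsumpos x hx y hy)).1 (hmin (x, y) (Finset.mem_offDiag.2 ⟨hx, hy, hxy⟩))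
  obtain ⟨F', hF', hcard, hsum, hU⟩ := (hF.scale hΛ1.le).exists_merge
    (Finset.mem_image_of_mem _ hp) (Finset.mem_image_of_mem _ hq)
    ((injective_scale_radius hΛ0.ne').ne hpq) (by
      rw [← mul_add, hΛdef, div_mul_cancel₀ _ (hsumpos p hp q hq).ne'])
  rw [iUnion_scaleDisks] at hU
  rw [sum_scaleDisks hΛ0.ne'] at hsum
  have hB := ih _ (hn ▸ hcard.trans_le Finset.card_image_le) hF' (s := Λ * s) (mul_pos hΛ0 hs)
    (hsum.trans (by gcongr)) rfl
  set B := ⋃ x ∈ F', closedBall x.1 x.2 with hBdef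
  have hBm : MeasurableSet B := Finset.measurableSet_biUnion _ fun _ _ => measurableSet_closedBall
  have hlog : E * Real.log (S / s) = E * Real.log Λ + E * Real.log (S / (Λ * s)) := by
    rw [← mul_add, ← Real.log_mul hΛ0.ne' (div_pos (hs.trans hsS) (mul_pos hΛ0 hs)).ne']
    congr 2
    field_simp
  have hannB : ⋃ p ∈ F, (ball p.1 (Λ * p.2) \ closedBall p.1 p.2) ⊆ B :=
    (Set.iUnion₂_mono fun p _ => Set.sdiff_subset.trans ball_subset_closedBall).trans hU
  calc ENNReal.ofReal (E * Real.log (S / s))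
      ≤ ENNReal.ofReal (E * Real.log Λ) + ENNReal.ofReal (E * Real.log (S / (Λ * s))) :=
        hlog ▸ ENNReal.ofReal_add_le
    _ ≤ (∫⁻ x in ⋃ p ∈ F, (ball p.1 (Λ * p.2) \ closedBall p.1 p.2), f x) +
          ∫⁻ x in Ω \ B, f x := add_le_add hA hB
    _ = ∫⁻ x in (⋃ p ∈ F, (ball p.1 (Λ * p.2) \ closedBall p.1 p.2)) ∪ (Ω \ B), f x :=
        (lintegral_union (hΩm.diff hBm)
          (Set.disjoint_left.2 fun x hx hx' => hx'.2 (hannB hx))).symm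
    _ ≤ ∫⁻ x in Ω \ ⋃ p ∈ F, closedBall p.1 p.2, f x := by
        refine lintegral_mono_set (Set.union_subset hAsub (Set.sdiff_subset_sdiff_right ?_))
        exact (Set.iUnion₂_mono fun p hp =>
          closedBall_subset_closedBall_mul _ hΛ1.le (hF.pos p hp).le).trans hU

theorem ball_sInf_dist_frontier_subset {K Ω : Set ℂ} (hΩ : IsOpen Ω) (hKΩ : K ⊆ Ω) {x : ℂ}
    (hx : x ∈ K) : ball x (sInf (Set.image2 dist K (frontier Ω))) ⊆ Ω := by
  rcases le_or_gt (sInf (Set.image2 dist K (frontier Ω))) 0 with h0 | h0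
  · simp [ball_eq_empty.2 h0]
  refine (convex_ball x _).isPreconnected.subset_left_of_subset_union hΩ
    (isClosed_closure (s := Ω)).isOpen_compl
    (disjoint_compl_right.mono_left subset_closure) (fun y hy => ?_)
    ⟨x, mem_ball_self h0, hKΩ hx⟩
  by_contra hy'
  rw [Set.mem_union, Set.mem_compl_iff, not_or, not_not] at hy'
  have hfr : y ∈ frontier Ω := by
    rw [hΩ.frontier_eq]
    exact ⟨hy'.2, hy'.1⟩
  have hle : sInf (Set.image2 dist K (frontier Ω)) ≤ dist x y := by
    refine csInf_le ⟨0, ?_⟩ (Set.mem_image2_of_mem hx hfr)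
    rintro _ ⟨a, -, b, -, rfl⟩
    exact dist_nonneg
  rw [mem_ball, dist_comm] at hy
  linarith

theorem exists_isDiskCover_of_H1content_lt {K : Set ℂ} (hK : K.Nonempty) {s : ℝ}
    (h : H1content K < ENNReal.ofReal (2 * s)) :
    ∃ F, IsDiskCover K F ∧ ∑ p ∈ F, p.2 ≤ s := by
  classical
  rw [H1content] at h
  simp only [iInf_lt_iff] at h
  obtain ⟨F₀, hcov, hsum⟩ := h
  set F₁ := F₀.filter fun p => (closedBall p.1 p.2 ∩ K).Nonempty with hF₁
  have hmem : ∀ x ∈ K, ∃ p ∈ F₁, x ∈ closedBall p.1 p.2 := fun x hx => by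
    obtain ⟨p, hp, hxp⟩ := Set.mem_iUnion₂.1 (hcov hx)
    exact ⟨p, Finset.mem_filter.2 ⟨hp, x, hxp, hx⟩, hxp⟩
  have hne : F₁.Nonempty := by
    obtain ⟨x, hx⟩ := hK
    obtain ⟨p, hp, -⟩ := hmem x hx
    exact ⟨p, hp⟩
  have hrad : ∀ p ∈ F₁, 0 ≤ p.2 := fun p hp =>
    nonempty_closedBall.1 (Finset.mem_filter.1 hp).2.left
  have hsum₁ : ∑ p ∈ F₁, p.2 < s := by
    have h1 : ∑ p ∈ F₁, ENNReal.ofReal (2 * p.2) ≤ ∑ p ∈ F₀, ENNReal.ofReal (2 * p.2) :=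
      Finset.sum_le_sum_of_subset (Finset.filter_subset _ _)
    rw [← ENNReal.ofReal_sum_of_nonneg fun p hp => mul_nonneg zero_le_two (hrad p hp)] at h1
    have h2 := (ENNReal.ofReal_lt_ofReal_iff_of_nonneg (Finset.sum_nonneg fun p hp =>
      mul_nonneg zero_le_two (hrad p hp))).1 (h1.trans_lt hsum)
    rw [← Finset.mul_sum] at h2
    linarith
  have hcard : (0 : ℝ) < F₁.card := by exact_mod_cast hne.card_pos
  set ε := (s - ∑ p ∈ F₁, p.2) / F₁.card with hε
  have hε0 : 0 < ε := div_pos (sub_pos.2 hsum₁) hcard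
  have hinj : Function.Injective fun p : ℂ × ℝ => (p.1, p.2 + ε) := fun p q h => by
    simp only [Prod.mk.injEq] at h
    exact Prod.ext h.1 (add_right_cancel h.2)
  have hball : ∀ p : ℂ × ℝ, closedBall p.1 p.2 ⊆ closedBall p.1 (p.2 + ε) := fun p =>
    closedBall_subset_closedBall (by linarith)
  refine ⟨F₁.image fun p => (p.1, p.2 + ε), ⟨hne.image _, ?_, ?_, ?_⟩, ?_⟩
  · intro p hp
    obtain ⟨q, hq, rfl⟩ := Finset.mem_image.1 hp
    exact add_pos_of_nonneg_of_pos (hrad q hq) hε0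
  · intro p hp
    obtain ⟨q, hq, rfl⟩ := Finset.mem_image.1 hp
    exact (Finset.mem_filter.1 hq).2.mono (Set.inter_subset_inter_left _ (hball q))
  · intro x hx
    obtain ⟨p, hp, hxp⟩ := hmem x hx
    exact Set.mem_iUnion₂.2 ⟨(p.1, p.2 + ε), Finset.mem_image_of_mem _ hp, hball p hxp⟩
  · rw [Finset.sum_image hinj.injOn]
    simp only
    rw [Finset.sum_add_distrib, Finset.sum_const, nsmul_eq_mul, hε, mul_div_cancel₀ _ hcard.ne']
    linarith

theorem singularEnergy_le_sum_lintegral_circles {ν : ℕ} {N U : Set (EuclideanSpace ℝ (Fin ν))}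
    (hN : IsCompact N) (hU : IsOpen U) (hNU : N ⊆ U)
    {r : EuclideanSpace ℝ (Fin ν) → EuclideanSpace ℝ (Fin ν)}
    (hr : ContDiffOn ℝ 1 r U) (hrN : ∀ x ∈ U, r x ∈ N) (hrid : ∀ x ∈ N, r x = x)
    {Ω K : Set ℂ} (hΩ : IsOpen Ω) (hK : IsClosed K) {v : ℂ → EuclideanSpace ℝ (Fin ν)}
    (hvc : ContinuousOn v (closure Ω \ K)) (hvd : DifferentiableOn ℝ v (Ω \ K))
    (hvN : ∀ x ∈ closure Ω \ K, v x ∈ N) {F : Finset (ℂ × ℝ)} (hF : IsDiskCover K F) {c : ℝ}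
    (hc : 1 < c)
    (hdisj : ∀ p ∈ F, ∀ q ∈ F, p ≠ q →
      Disjoint (closedBall p.1 (c * p.2)) (closedBall q.1 (c * q.2)))
    (hsub : ∀ p ∈ F, closedBall p.1 (c * p.2) ⊆ Ω) :
    ENNReal.ofReal (singularEnergy N Ω v) ≤ ∑ p ∈ F, ENNReal.ofReal ((c * p.2) ^ 2) *
      ∫⁻ θ in Set.Ioo (-π) π,
        ENNReal.ofReal (‖fderiv ℝ v (circleMap p.1 (c * p.2) θ)‖ ^ 2 / 2) := by
  have hpos : ∀ p ∈ F, 0 < c * p.2 := fun p hp => mul_pos (by linarith) (hF.pos p hp)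
  have hKU : K ⊆ ⋃ p ∈ F, ball p.1 (c * p.2) := hF.cover.trans (Set.iUnion₂_mono fun p hp =>
    closedBall_subset_ball (by nlinarith [hF.pos p hp]))
  have hsd := Set.sdiff_subset_sdiff_right (s := closure Ω) hKU
  have hmem : ∀ p ∈ F, ∀ t, circleMap p.1 (c * p.2) t ∈ Ω \ K := fun p hp t => by
    have hs := circleMap_mem_sphere p.1 (hpos p hp).le t
    refine ⟨hsub p hp (sphere_subset_closedBall hs), fun hmK => ?_⟩
    obtain ⟨q, hq, hmq⟩ := Set.mem_iUnion₂.1 (hKU hmK)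
    by_cases hqp : q = p
    · subst hqp
      exact (mem_ball.1 hmq).ne (mem_sphere.1 hs)
    · exact (hdisj q hq p hp hqp).le_bot
        ⟨ball_subset_closedBall hmq, sphere_subset_closedBall hs⟩
  calc ENNReal.ofReal (singularEnergy N Ω v)
      ≤ ENNReal.ofReal
          (∑ p ∈ F, minLength N (fun t => v (circleMap p.1 (c * p.2) t)) ^ 2 / (4 * π)) :=
        ENNReal.ofReal_le_ofReal (singularEnergy_le_sum_circles hΩ hF.nonempty hpos hdisj hsub
          (hvc.mono hsd) fun x hx => hvN x (hsd hx))
    _ = ∑ p ∈ F, ENNReal.ofReal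
          (minLength N (fun t => v (circleMap p.1 (c * p.2) t)) ^ 2 / (4 * π)) :=
        ENNReal.ofReal_sum_of_nonneg fun p _ => by positivity
    _ ≤ _ := Finset.sum_le_sum fun p hp =>
        minLength_sq_le_lintegral_circle hN hU hNU hr hrN hrid (hpos p hp)
          (fun t => hvN _ ⟨subset_closure (hmem p hp t).1, (hmem p hp t).2⟩)
          fun t => hvd.differentiableAt ((hΩ.sdiff hK).mem_nhds (hmem p hp t))

/-- Lower bound on the Dirichlet energy outside a compact set `K` with positive
one-dimensional Hausdorff content: for `v ∈ W^{1,2}(Ω \ K, N)`,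
`∫_{Ω\K} |Dv|²/2 ≥ E^sg(tr_∂Ω v) · log( dist(K,∂Ω) / (2·H¹_∞(K)) )`. -/
theorem energy_lower_bound_outside_compact
    {ν : ℕ} (N : Set (EuclideanSpace ℝ (Fin ν)))
    (hN : IsCompact N) (hNne : N.Nonempty)
    -- `N` is a smooth compact manifold (neighbourhood retract):
    (U : Set (EuclideanSpace ℝ (Fin ν))) (hU : IsOpen U) (hNU : N ⊆ U)
    (r : EuclideanSpace ℝ (Fin ν) → EuclideanSpace ℝ (Fin ν))
    (hr : ContDiffOn ℝ (⊤ : ℕ∞) r U) (hrN : ∀ x ∈ U, r x ∈ N) (hrid : ∀ x ∈ N, r x = x)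
    (Ω : Set ℂ) (hΩo : IsOpen Ω) (hΩb : Bornology.IsBounded Ω)
    (K : Set ℂ) (hK : IsCompact K) (hKΩ : K ⊆ Ω) (hKpos : 0 < H1content K)
    (v : ℂ → EuclideanSpace ℝ (Fin ν))
    (hvcont : ContinuousOn v (closure Ω \ K))
    (hvdiff : DifferentiableOn ℝ v (Ω \ K))
    (hvN : ∀ x ∈ closure Ω \ K, v x ∈ N)
    (hvint : IntegrableOn (fun x => ‖fderiv ℝ v x‖ ^ 2) (Ω \ K)) :
    ∫ x in Ω \ K, ‖fderiv ℝ v x‖ ^ 2 / 2 ≥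
      singularEnergy N Ω v *
        Real.log (sInf (Set.image2 dist K (frontier Ω)) /
          (2 * (H1content K).toReal)) := by
  set E := singularEnergy N Ω v
  set H := (H1content K).toReal with hHdef
  set d := sInf (Set.image2 dist K (frontier Ω)) with hd
  have hE : 0 ≤ E := singularEnergy_nonneg N Ω v
  have hI0 : 0 ≤ ∫ x in Ω \ K, ‖fderiv ℝ v x‖ ^ 2 / 2 := integral_nonneg fun _ => by positivity
  by_cases htop : H1content K = ⊤
  · simpa [hHdef, htop] using hI0
  have hH : 0 < H := ENNReal.toReal_pos hKpos.ne' htop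
  have hd0 : 0 ≤ d := Real.sInf_nonneg (by
    rintro _ ⟨a, -, b, -, rfl⟩
    exact dist_nonneg)
  have hKne : K.Nonempty := by
    rw [Set.nonempty_iff_ne_empty]
    rintro rfl
    refine hKpos.not_ge (iInf₂_le_of_le ∅ (Set.empty_subset _) ?_)
    simp
  have hlt : H1content K < ENNReal.ofReal (2 * H) := by
    rw [← ENNReal.ofReal_toReal htop, ← hHdef, ENNReal.ofReal_lt_ofReal_iff (by positivity)]
    linarith
  obtain ⟨F, hF, hFs⟩ := exists_isDiskCover_of_H1content_lt hKne hlt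
  have hball : ∀ x ∈ K, ball x (2 * (d / 2)) ⊆ Ω := fun x hx => by
    rw [mul_div_cancel₀ d two_ne_zero]
    exact ball_sInf_dist_frontier_subset hΩo hKΩ hx
  have hr1 : ContDiffOn ℝ 1 r U := hr.of_le (by exact_mod_cast le_top)
  have hgrow := ofReal_mul_log_le_lintegral_of_ball_growth (K := K) hΩo.measurableSet
    (f := fun x => ENNReal.ofReal (‖fderiv ℝ v x‖ ^ 2 / 2))
    (((measurable_fderiv ℝ v).norm.pow_const 2).div_const 2).ennreal_ofReal hE
    (div_nonneg hd0 zero_le_two) hball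
    (fun F hF c hc hcS hdisj => singularEnergy_le_sum_lintegral_circles hN hU hNU hr1 hrN hrid
      hΩo hK.isClosed hvcont hvdiff hvN hF hc hdisj fun p hp =>
        closedBall_subset_of_meets hball (hF.meets p hp) (by
          have h1 := Finset.single_le_sum (fun q hq => (hF.pos q hq).le) hp
          nlinarith [hF.pos p hp]))
    hF hH hFs
  have hmono := hgrow.trans (lintegral_mono_set (Set.sdiff_subset_sdiff_right hF.cover))
  rw [← ofReal_integral_eq_lintegral_ofReal (hvint.div_const 2)
    (Filter.Eventually.of_forall fun x => by positivity),
    ENNReal.ofReal_le_ofReal_iff hI0, div_div] at hmono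
  exact hmono
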